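/- There is a universal constant C > 0 such that for every ε > 0, β ∈ (0,1), and integers d ≥ 1, T ≥ 1 (T known, but with no a priori bound on the total update count), there exists an ε-differentially private (user level) continual-observation set-cardinality mechanism over users [d] with stream length T such that for every set-cardinality stream of length T, letting K ≥ 1 denote its total update count, the mechanism has error at most C · min( d, K, log K · √( ε^{-1} · K · log(T/β) ) ) at all time steps with probability at least 1 − β. -/

import Mathlib

open MeasureTheory

/-- Base-2 logarithm where the argument is clamped below by 2. -/
noncomputable def log2c (z : ℝ) : ℝ := Real.logb 2 (max z 2)

/-- An operation of a set-cardinality stream over users `Fin d`: a flag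
(`true` = insert, `false` = delete) together with the affected subset. -/
def CardOp (d : ℕ) : Type := Bool × Finset (Fin d)

instance {d : ℕ} : MeasurableSpace (CardOp d) := ⊤

/-- Apply a set-cardinality operation to the maintained set. -/
def CardOp.apply {d : ℕ} (D : Finset (Fin d)) (op : CardOp d) : Finset (Fin d) :=
  if op.1 then D ∪ op.2 else D \ op.2

/-- The maintained set after the first `n` operations of an infinite stream. -/
def DcardN {d : ℕ} (x : ℕ → CardOp d) : ℕ → Finset (Fin d)
  | 0 => ∅
  | n + 1 => CardOp.apply (DcardN x n) (x n)

/-- The maintained set `D_t` after the first `t+1` operations of a finite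
stream (time steps 0-indexed). -/
def Dcard {d T : ℕ} (x : Fin T → CardOp d) (t : Fin T) : Finset (Fin d) :=
  DcardN (fun n => if h : n < T then x ⟨n, h⟩ else ((true, ∅) : CardOp d)) (t.1 + 1)

/-- The total update count of a finite stream: the total number of
(element, time step) pairs such that the element is inserted or deleted at
that time step. -/
def updateCount {d T : ℕ} (x : Fin T → CardOp d) : ℕ :=
  ∑ t : Fin T, (x t).2.card

/-- Two streams are user-level neighboring if removing some single user from
every operation of both streams yields identical streams. -/
def UserNeighboring {d T : ℕ} (x y : Fin T → CardOp d) : Prop :=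
  ∃ i : Fin d, ∀ t : Fin T,
    (x t).1 = (y t).1 ∧ (x t).2.erase i = (y t).2.erase i

/-- A continual-observation set-cardinality mechanism: a measurable assignment
of output distributions to input streams whose outputs up to time `t` depend
only on the first `t` operations. -/
def IsCOMech {d T : ℕ} (M : (Fin T → CardOp d) → Measure (Fin T → ℝ)) : Prop :=
  Measurable M ∧ (∀ x, IsProbabilityMeasure (M x)) ∧
    ∀ (t : Fin T) (x y : Fin T → CardOp d), (∀ s, s ≤ t → x s = y s) →
      (M x).map (fun a (s : {s : Fin T // s ≤ t}) => a s.1) =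
      (M y).map (fun a (s : {s : Fin T // s ≤ t}) => a s.1)

/-- `ε`-differential privacy at user level. -/
def IsUserDP {d T : ℕ} (ε : ℝ)
    (M : (Fin T → CardOp d) → Measure (Fin T → ℝ)) : Prop :=
  ∀ x y, UserNeighboring x y → ∀ S : Set (Fin T → ℝ), MeasurableSet S →
    M x S ≤ ENNReal.ofReal (Real.exp ε) * M y S


theorem exists_geom (η : ℝ) (hη : 0 < η) : ∃ p : PMF ℕ,
    (∀ k, p k ≤ ENNReal.ofReal (Real.exp η) * p (k+1)) ∧
    ∀ G : ℝ, p.toOuterMeasure {g | G < (g:ℝ)} ≤ ENNReal.ofReal (Real.exp (-(η*G))) := by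
  have h1 : Real.exp (-η) < 1 := by simpa using hη
  have h0 := Real.exp_pos (-η)
  have hs : HasSum (fun k : ℕ => ENNReal.ofReal ((1 - Real.exp (-η)) * Real.exp (-η)^k)) 1 := by
    have := (hasSum_geometric_of_lt_one h0.le h1).mul_left (1 - Real.exp (-η))
    rw [mul_inv_cancel₀ (by linarith)] at this
    have h2 := ENNReal.ofReal_tsum_of_nonneg (f := fun k : ℕ => (1 - Real.exp (-η)) * Real.exp (-η)^k)
      (fun n => by have : 0 < 1 - Real.exp (-η) := by linarith
                   positivity) this.summable
    rw [this.tsum_eq, ENNReal.ofReal_one] at h2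
    rw [h2]; exact ENNReal.summable.hasSum
  have key : ∀ k m : ℕ, ENNReal.ofReal ((1 - Real.exp (-η)) * Real.exp (-η)^(k+m)) =
      ENNReal.ofReal (Real.exp (-η)^m) * ENNReal.ofReal ((1 - Real.exp (-η)) * Real.exp (-η)^k) := by
    intro k m
    rw [← ENNReal.ofReal_mul (by positivity)]; congr 1; ring
  refine ⟨⟨_, hs⟩, ?_, ?_⟩
  · intro k
    change ENNReal.ofReal _ ≤ _ * ENNReal.ofReal _
    rw [key k 1, ← mul_assoc, ← ENNReal.ofReal_mul (by positivity), pow_one, ← Real.exp_add]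
    simp
  · intro G
    set p : PMF ℕ := ⟨_, hs⟩
    have hp : ∀ k m : ℕ, p (k+m) = ENNReal.ofReal (Real.exp (-η)^m) * p k := key
    set N := ⌈G⌉₊
    calc p.toOuterMeasure {g | G < (g:ℝ)} ≤ p.toOuterMeasure {g | N ≤ g} := by
          apply p.toOuterMeasure.mono
          intro g hg
          exact Nat.ceil_le.2 (le_of_lt hg)
      _ = ∑' k, p (k + N) := by
          rw [PMF.toOuterMeasure_apply]
          have : Function.Injective (fun k => k + N) := add_left_injective N
          rw [← this.tsum_eq (f := Set.indicator {g | N ≤ g} p)]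
          · simp
          · intro k hk
            simp at hk
            exact ⟨k - N, by simp; omega⟩
      _ = ENNReal.ofReal (Real.exp (-η)^N) := by
          simp_rw [hp]
          rw [ENNReal.tsum_mul_left, p.tsum_coe, mul_one]
      _ ≤ _ := by
          apply ENNReal.ofReal_le_ofReal
          rw [← Real.exp_nat_mul]
          apply Real.exp_le_exp.2
          have := Nat.le_ceil G
          nlinarith

structure StK where
  i : ℕ × ℕ
  c : ℤ
  r : ℕ

noncomputable section
open Classical

def nxtK (S : ℕ → ℕ) (i : ℕ × ℕ) : ℕ × ℕ := if S i.1 ≤ i.2 + 1 then (i.1 + 1, 0) else (i.1, i.2+1)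

def jmpK (pm : ℕ → PMF ℕ) (S : ℕ → ℕ) (s : StK) (n : ℕ) : PMF StK :=
  (pm s.i.1).bind fun g1 => (pm s.i.1).bind fun g2 => (pm s.i.1).bind fun g3 =>
    PMF.pure ⟨nxtK S s.i, (n:ℤ) + g1 - g2, g3⟩

def stpK (pm : ℕ → PMF ℕ) (a : ℕ → ℝ) (S : ℕ → ℕ) (s : StK) (n : ℕ) : PMF StK :=
  (pm s.i.1).bind fun g =>
    if (s.r:ℝ) + a s.i.1 ≤ |(n:ℝ) - s.c| + g then jmpK pm S s n else PMF.pure s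

def runK (pm : ℕ → PMF ℕ) (a : ℕ → ℝ) (S : ℕ → ℕ) (n : ℕ → ℕ) : ℕ → ℕ → StK → PMF (List ℤ)
  | 0, _, _ => PMF.pure []
  | k+1, t, s => (stpK pm a S s (n (t+1))).bind fun s' =>
      (runK pm a S n k (t+1) s').map (fun l => s'.c :: l)

theorem shiftK (p : PMF ℕ) (e : ENNReal) (k : ℕ) (hp : ∀ k, p k ≤ e * p (k+1)) (F F' : ℕ → ENNReal)
    (c : ENNReal)
    (h : ∀ g, F g ≤ c * F' (g+k)) : ∑' g, p g * F g ≤ e^k * c * ∑' g, p g * F' g := by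
  have hk : ∀ g, p g ≤ e^k * p (g+k) := by
    clear h
    intro g
    induction k with
    | zero => simp
    | succ k ih =>
      calc p g ≤ e^k * p (g+k) := ih
        _ ≤ e^k * (e * p (g+k+1)) := by gcongr; exact hp _
        _ = _ := by rw [pow_succ, mul_assoc]; rfl
  calc ∑' g, p g * F g ≤ ∑' g, (e^k * c) * (p (g+k) * F' (g+k)) := by
        apply ENNReal.tsum_le_tsum
        intro g
        calc p g * F g ≤ (e^k * p (g+k)) * (c * F' (g+k)) := mul_le_mul' (hk g) (h g)
          _ = _ := by ring
    _ = (e^k * c) * ∑' g, (p (g+k) * F' (g+k)) := ENNReal.tsum_mul_left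
    _ ≤ _ := by
      exact mul_le_mul_right (ENNReal.tsum_comp_le_tsum_of_injective (add_left_injective k) (fun g => p g * F' g)) _

theorem boundK {α β : Type*} (p : PMF α) (f : α → PMF β) (A : Set β) (B : Set α) (b c : ENNReal)
    (hB : p.toOuterMeasure B ≤ b) (h : ∀ a, a ∉ B → (f a).toOuterMeasure A ≤ c) :
    (p.bind f).toOuterMeasure A ≤ b + c := by
  rw [PMF.toOuterMeasure_bind_apply]
  calc ∑' a, p a * (f a).toOuterMeasure A ≤ ∑' a, (B.indicator p a + p a * c) := by
        apply ENNReal.tsum_le_tsum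
        intro a
        by_cases ha : a ∈ B
        · simp only [Set.indicator_of_mem ha]
          refine le_trans ?_ le_self_add
          calc _ ≤ p a * 1 := by
                gcongr
                rw [PMF.toOuterMeasure_apply]
                calc _ ≤ ∑' x, (f a) x := ENNReal.tsum_le_tsum fun x => Set.indicator_le_self _ _ _
                  _ = 1 := PMF.tsum_coe _
            _ = p a := mul_one _
        · refine le_trans ?_ le_add_self
          gcongr
          exact h a ha
    _ = p.toOuterMeasure B + c := by
        rw [ENNReal.tsum_add, ENNReal.tsum_mul_right, p.tsum_coe, one_mul, PMF.toOuterMeasure_apply]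
    _ ≤ _ := by gcongr

theorem privK (pm : ℕ → PMF ℕ) (a : ℕ → ℝ) (S : ℕ → ℕ) (η : ℕ → ℝ) (B : ℕ × ℕ → ℝ)
    (hpm : ∀ j k, pm j k ≤ ENNReal.ofReal (Real.exp (η j)) * pm j (k+1))
    (hη : ∀ j, 0 ≤ η j) (hB0 : ∀ i, 0 ≤ B i)
    (hB : ∀ i, 4 * η i.1 + B (nxtK S i) ≤ B i)
    (nx ny : ℕ → ℕ) (hn : ∀ t, nx t = ny t ∨ nx t = ny t + 1 ∨ ny t = nx t + 1)
    (k : ℕ) : ∀ (t : ℕ) (s : StK) (A : Set (List ℤ)),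
      (runK pm a S nx k t s).toOuterMeasure A ≤ ENNReal.ofReal (Real.exp (B s.i)) *
        (runK pm a S ny k t ⟨s.i, s.c, s.r+1⟩).toOuterMeasure A := by
  induction k with
  | zero =>
    intro t s A
    simp only [runK]
    have : (1 : ENNReal) ≤ ENNReal.ofReal (Real.exp (B s.i)) := by
      rw [ENNReal.one_le_ofReal]; exact Real.one_le_exp (hB0 _)
    exact le_mul_of_one_le_left' this
  | succ k ih =>
    intro t s A
    obtain ⟨i, c, r⟩ := s
    simp only [runK]
    set e := ENNReal.ofReal (Real.exp (η i.1)) with he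
    set Rx : StK → ENNReal := fun s' => ((runK pm a S nx k (t+1) s').map (fun l => s'.c :: l)).toOuterMeasure A with hRx
    set Ry : StK → ENNReal := fun s' => ((runK pm a S ny k (t+1) s').map (fun l => s'.c :: l)).toOuterMeasure A with hRy
    have hR : ∀ s' : StK, Rx s' ≤ ENNReal.ofReal (Real.exp (B s'.i)) * Ry ⟨s'.i, s'.c, s'.r+1⟩ := by
      intro s'
      simp only [hRx, hRy, PMF.toOuterMeasure_map_apply]
      exact ih _ _ _
    set X := ∑' g1, pm i.1 g1 * ∑' g2, pm i.1 g2 * ∑' g3, pm i.1 g3 * Rx ⟨nxtK S i, (nx (t+1) :ℤ) + g1 - g2, g3⟩ with hX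
    set Y := ∑' g1, pm i.1 g1 * ∑' g2, pm i.1 g2 * ∑' g3, pm i.1 g3 * Ry ⟨nxtK S i, (ny (t+1) :ℤ) + g1 - g2, g3⟩ with hY
    have ex : ∀ r' : ℕ, ((stpK pm a S ⟨i,c,r'⟩ (nx (t+1))).bind fun s' =>
      (runK pm a S nx k (t+1) s').map (fun l => s'.c :: l)).toOuterMeasure A =
      ∑' g, pm i.1 g * if (r':ℝ) + a i.1 ≤ |(nx (t+1):ℝ) - c| + g then X else Rx ⟨i,c,r'⟩ := by
      intro r'
      rw [stpK, PMF.bind_bind, PMF.toOuterMeasure_bind_apply]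
      congr 1; ext g; congr 1
      split_ifs with h
      · simp only [jmpK, PMF.bind_bind, PMF.pure_bind, PMF.toOuterMeasure_bind_apply]; rfl
      · simp only [PMF.pure_bind]; rfl
    have ey : ∀ r' : ℕ, ((stpK pm a S ⟨i,c,r'⟩ (ny (t+1))).bind fun s' =>
      (runK pm a S ny k (t+1) s').map (fun l => s'.c :: l)).toOuterMeasure A =
      ∑' g, pm i.1 g * if (r':ℝ) + a i.1 ≤ |(ny (t+1):ℝ) - c| + g then Y else Ry ⟨i,c,r'⟩ := by
      intro r'
      rw [stpK, PMF.bind_bind, PMF.toOuterMeasure_bind_apply]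
      congr 1; ext g; congr 1
      split_ifs with h
      · simp only [jmpK, PMF.bind_bind, PMF.pure_bind, PMF.toOuterMeasure_bind_apply]; rfl
      · simp only [PMF.pure_bind]; rfl
    rw [ex, ey]
    have he1 : 1 ≤ e := by
      rw [he, ENNReal.one_le_ofReal]; exact Real.one_le_exp (hη _)
    set b' := ENNReal.ofReal (Real.exp (B (nxtK S i))) with hb'
    set b := ENNReal.ofReal (Real.exp (B i)) with hb
    have hbb : e^4 * b' ≤ b := by
      rw [he, hb', hb, ← ENNReal.ofReal_pow (Real.exp_pos _).le, ← ENNReal.ofReal_mul (by positivity),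
        ← Real.exp_nat_mul, ← Real.exp_add]
      exact ENNReal.ofReal_le_ofReal (Real.exp_le_exp.2 (by simpa using hB i))
    have h3 : ∀ z : ℤ, ∑' g3, pm i.1 g3 * Rx ⟨nxtK S i, z, g3⟩ ≤ e^1 * b' * ∑' g3, pm i.1 g3 * Ry ⟨nxtK S i, z, g3⟩ := by
      intro z
      exact shiftK _ _ 1 (hpm i.1) _ _ _ fun g => hR ⟨nxtK S i, z, g⟩
    have hXY : X ≤ e^2 * b' * Y := by
      have hsh : ∀ k1 k2 : ℕ, k1 + k2 ≤ 1 → (nx (t+1) : ℤ) + k2 = ny (t+1) + k1 → X ≤ e^2 * b' * Y := by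
        intro k1 k2 hk hnn
        have h2 : ∀ g1 : ℕ, (∑' g2, pm i.1 g2 * ∑' g3, pm i.1 g3 * Rx ⟨nxtK S i, (nx (t+1) :ℤ) + g1 - g2, g3⟩)
           ≤ (e^k2 * (e^1 * b')) * (∑' g2, pm i.1 g2 * ∑' g3, pm i.1 g3 * Ry ⟨nxtK S i, (ny (t+1) :ℤ) + (g1+k1 : ℕ) - g2, g3⟩) := by
          intro g1
          refine shiftK _ _ k2 (hpm i.1) _ _ _ fun g2 => ?_
          have : (ny (t+1) :ℤ) + (g1+k1 : ℕ) - (g2 + k2 : ℕ) = (nx (t+1) :ℤ) + g1 - g2 := by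
            push_cast; linarith
          rw [this]
          exact h3 _
        have h1 := shiftK _ _ k1 (hpm i.1) _ (fun g1 : ℕ => ∑' g2, pm i.1 g2 * ∑' g3, pm i.1 g3 * Ry ⟨nxtK S i, (ny (t+1) :ℤ) + (g1 : ℕ) - g2, g3⟩) _ h2
        refine h1.trans ?_
        rw [← hY]
        refine mul_le_mul_left ?_ _
        calc e^k1 * (e^k2 * (e^1 * b')) = e^(k1+k2) * e * b' := by rw [pow_add]; ring
          _ ≤ e^1 * e * b' := mul_le_mul_left (mul_le_mul_left (pow_le_pow_right₀ he1 hk) _) _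
          _ = e^2 * b' := by ring
      rcases hn (t+1) with h | h | h
      · exact hsh 0 0 (by simp) (by simp [h])
      · exact hsh 1 0 (by simp) (by simp [h])
      · exact hsh 0 1 (by simp) (by simp [h])
    have habs : |(nx (t+1) : ℝ) - ny (t+1)| ≤ 1 := by
      rcases hn (t+1) with h | h | h <;> simp [h]
    have hab1 : |(nx (t+1) : ℝ) - c| ≤ |(ny (t+1) : ℝ) - c| + 1 := by
      have := abs_sub_le (nx (t+1) : ℝ) (ny (t+1)) c
      linarith
    have hab2 : |(ny (t+1) : ℝ) - c| ≤ |(nx (t+1) : ℝ) - c| + 1 := by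
      have := abs_sub_le (ny (t+1) : ℝ) (nx (t+1)) c
      rw [abs_sub_comm] at habs
      linarith
    have hsplit : ∀ (P : ℕ → Prop) (V W : ENNReal), ∑' g, pm i.1 g * (if P g then V else W) =
        ∑' g, pm i.1 g * (if P g then V else 0) + ∑' g, pm i.1 g * (if P g then 0 else W) := by
      intro P V W
      rw [← ENNReal.tsum_add]
      congr 1; ext g
      split_ifs <;> simp
    rw [hsplit _ X, hsplit _ Y, mul_add]
    apply add_le_add
    · have : ∑' g, pm i.1 g * (if (r:ℝ) + a i.1 ≤ |(nx (t+1):ℝ) - c| + g then X else 0) ≤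
        e^2 * (e^2 * b') * ∑' g, pm i.1 g * (if ((r+1:ℕ):ℝ) + a i.1 ≤ |(ny (t+1):ℝ) - c| + g then Y else 0) := by
        refine shiftK _ _ 2 (hpm i.1) _ _ _ fun g => ?_
        split_ifs with h h'
        · exact hXY
        · exfalso; apply h'; push_cast; linarith
        · simp
        · simp
      refine this.trans ?_
      gcongr
      refine le_trans (le_of_eq ?_) hbb
      ring
    · rw [← ENNReal.tsum_mul_left]
      apply ENNReal.tsum_le_tsum
      intro g
      split_ifs with h h' h'
      · simp
      · simp
      · exfalso; apply h; push_cast at h'; linarith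
      · calc _ ≤ pm i.1 g * (b * Ry ⟨i, c, r+1⟩) := by gcongr; exact hR ⟨i,c,r⟩
          _ = _ := by ring

theorem causK1 (pm : ℕ → PMF ℕ) (a : ℕ → ℝ) (S : ℕ → ℕ) (n : ℕ → ℕ) (k : ℕ) :
    ∀ (T t : ℕ) (s : StK), k ≤ T →
    (runK pm a S n T t s).map (List.take k) = runK pm a S n k t s := by
  induction k with
  | zero =>
    intro T t s h
    simp only [runK]
    exact PMF.map_const _ _
  | succ k ih =>
    intro T t s h
    obtain ⟨T, rfl⟩ : ∃ T', T = T'+1 := ⟨T-1, by omega⟩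
    simp only [runK, PMF.map_bind]
    congr 1; ext1 s'
    rw [← ih T (t+1) s' (by omega), PMF.map_comp, PMF.map_comp]
    congr 1

theorem causK2 (pm : ℕ → PMF ℕ) (a : ℕ → ℝ) (S : ℕ → ℕ) (n n' : ℕ → ℕ) (k : ℕ) :
    ∀ (t : ℕ) (s : StK), (∀ i, i ≤ t + k → n i = n' i) →
    runK pm a S n k t s = runK pm a S n' k t s := by
  induction k with
  | zero => intro t s h; rfl
  | succ k ih =>
    intro t s h
    simp only [runK]
    rw [h (t+1) (by omega)]
    congr 1; ext1 s'
    rw [ih (t+1) s' (fun i hi => h i (by omega))]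

def PK (Gam Q : ℕ → ℝ) (j : ℕ) (u : ℝ) : Prop :=
  (j = 0 ∧ Gam 0 ≤ u) ∨ ∃ k, j = k + 1 ∧ Q k ≤ u

theorem PK.mono {Gam Q : ℕ → ℝ} {j : ℕ} {u v : ℝ} (h : PK Gam Q j u) (huv : u ≤ v) : PK Gam Q j v := by
  rcases h with ⟨h, h'⟩ | ⟨k, h, h'⟩
  · exact Or.inl ⟨h, h'.trans huv⟩
  · exact Or.inr ⟨k, h, h'.trans huv⟩

def InvK (Gam Q : ℕ → ℝ) (s : StK) (n U : ℕ) : Prop :=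
  ∃ n0 u0 : ℝ, |(s.c:ℝ) - n0| ≤ Gam s.i.1 ∧ |(n:ℝ) - n0| ≤ U - u0 ∧ (s.i.2:ℝ) * Gam s.i.1 ≤ u0 ∧
    (s.r : ℝ) ≤ Gam s.i.1 ∧ ((s.c = 0 ∧ s.i.1 = 0 ∧ n0 = 0 ∧ u0 = 0) ∨ PK Gam Q s.i.1 u0)

theorem stepaccK (pm : ℕ → PMF ℕ) (S : ℕ → ℕ) (Gam Q : ℕ → ℝ) (δ : ENNReal)
    (hG0 : ∀ j, 0 ≤ Gam j) (hGm : Monotone Gam) (hSQ : ∀ j, Q j ≤ S j * Gam j)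
    (hδ : ∀ j, (pm j).toOuterMeasure {g | Gam j < (g:ℝ)} ≤ δ)
    (n U n' U' : ℕ) (hU : |(n':ℝ) - n| ≤ U' - U) (K E : ℝ) (hUK : (U':ℝ) ≤ K)
    (hE0 : min K (4 * Gam 0) ≤ E) (hE1 : ∀ j, PK Gam Q j K → 4 * Gam j ≤ E)
    (s : StK) (hs : InvK Gam Q s n U) :
    (stpK pm (fun j => 3 * Gam j) S s n').toOuterMeasure
      {s' | ¬ (InvK Gam Q s' n' U' ∧ |(s'.c:ℝ) - n'| ≤ E)} ≤ 4 * δ := by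
  obtain ⟨n0, u0, h1, h2, h3, h4, h5⟩ := hs
  have hn : |(n':ℝ) - n0| ≤ U' - u0 := by
    have := abs_sub_le (n':ℝ) n n0
    linarith
  have e4 : 4 * δ = δ + (δ + (δ + (δ + 0))) := by ring
  have pure0 : ∀ (A : Set StK) (a : StK), a ∉ A → (PMF.pure a).toOuterMeasure A ≤ 0 := by
    intro A a h; rw [PMF.toOuterMeasure_pure_apply, if_neg h]
  have hu0 : u0 ≤ K := by
    have := abs_nonneg ((n':ℝ) - n0)
    linarith
  rw [e4, stpK]
  refine boundK _ _ _ _ _ _ (hδ s.i.1) fun g hg => ?_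
  have hg' : (g:ℝ) ≤ Gam s.i.1 := by simpa using hg
  split_ifs with htr
  · rw [jmpK]
    refine boundK _ _ _ _ _ _ (hδ s.i.1) fun g1 hg1 => ?_
    refine boundK _ _ _ _ _ _ (hδ s.i.1) fun g2 hg2 => ?_
    refine boundK _ _ _ _ _ _ (hδ s.i.1) fun g3 hg3 => ?_
    apply pure0
    have hg1' : (g1:ℝ) ≤ Gam s.i.1 := by simpa using hg1
    have hg2' : (g2:ℝ) ≤ Gam s.i.1 := by simpa using hg2
    have hg3' : (g3:ℝ) ≤ Gam s.i.1 := by simpa using hg3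
    have g10 : (0:ℝ) ≤ g1 := Nat.cast_nonneg _
    have g20 : (0:ℝ) ≤ g2 := Nat.cast_nonneg _
    simp only [Set.mem_ofPred_eq, not_not]
    have hj : Gam s.i.1 ≤ Gam (nxtK S s.i).1 := by
      apply hGm; unfold nxtK; split_ifs <;> simp
    have hc : |(((n':ℤ) + g1 - g2 : ℤ) : ℝ) - n'| ≤ Gam s.i.1 := by
      push_cast
      rw [abs_le]; constructor <;> linarith
    have hr0 : (0:ℝ) ≤ s.r := Nat.cast_nonneg _
    have hUg : Gam s.i.1 ≤ U' - u0 := by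
      have := abs_sub_le (n':ℝ) n0 s.c
      rw [abs_sub_comm n0] at this
      linarith
    have hm : ((s.i.2:ℝ) + 1) * Gam s.i.1 ≤ U' := by linarith
    have hP : PK Gam Q (nxtK S s.i).1 U' := by
      unfold nxtK
      split_ifs with hS
      · right
        refine ⟨s.i.1, rfl, (hSQ _).trans (le_trans ?_ hm)⟩
        have : (S s.i.1 : ℝ) ≤ s.i.2 + 1 := by exact_mod_cast hS
        exact mul_le_mul_of_nonneg_right this (hG0 _)
      · simp only
        rcases h5 with ⟨_, h0, _, h0'⟩ | h5
        · left; refine ⟨h0, ?_⟩; rw [h0] at hUg; linarith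
        · exact h5.mono (by linarith [hG0 s.i.1])
    refine ⟨⟨n', U', hc.trans hj, by simp, ?_, hg3'.trans hj, Or.inr hP⟩, ?_⟩
    · simp only
      unfold nxtK
      split_ifs with hS
      · simp
      · push_cast; exact hm
    · have := hE1 _ (hP.mono hUK)
      linarith [hG0 (nxtK S s.i).1]
  · refine le_trans (pure0 _ _ ?_) zero_le
    simp only [Set.mem_ofPred_eq, not_not]
    have hg0 : (0:ℝ) ≤ g := Nat.cast_nonneg _
    push Not at htr
    have herr : |(s.c:ℝ) - n'| ≤ 4 * Gam s.i.1 := by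
      rw [abs_sub_comm]; linarith
    refine ⟨⟨n0, u0, h1, hn, h3, h4, h5⟩, ?_⟩
    rcases h5 with ⟨hc, h0, hn0, h0'⟩ | h5
    · refine le_trans (le_min ?_ ?_) hE0
      · rw [hc, abs_sub_comm]; rw [hn0, h0'] at hn
        have hn2 : (n':ℝ) ≤ U' := by simpa using hn
        simp; linarith
      · rw [← h0]; exact herr
    · exact herr.trans (hE1 _ (h5.mono hu0))

theorem accK (pm : ℕ → PMF ℕ) (S : ℕ → ℕ) (Gam Q : ℕ → ℝ) (δ : ENNReal)
    (hG0 : ∀ j, 0 ≤ Gam j) (hGm : Monotone Gam) (hSQ : ∀ j, Q j ≤ S j * Gam j)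
    (hδ : ∀ j, (pm j).toOuterMeasure {g | Gam j < (g:ℝ)} ≤ δ)
    (n U : ℕ → ℕ) (hU : ∀ t, |(n (t+1):ℝ) - n t| ≤ U (t+1) - U t) (K E : ℝ) (hUK : ∀ t, (U t:ℝ) ≤ K)
    (hE0 : min K (4 * Gam 0) ≤ E) (hE1 : ∀ j, PK Gam Q j K → 4 * Gam j ≤ E) (k : ℕ) :
    ∀ (t : ℕ) (s : StK), InvK Gam Q s (n t) (U t) →
    (runK pm (fun j => 3 * Gam j) S n k t s).toOuterMeasure
      {l | ¬ ∀ i < k, |((l.getD i 0 : ℤ):ℝ) - n (t+1+i)| ≤ E} ≤ k * (4 * δ) := by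
  induction k with
  | zero => intro t s hs; simp
  | succ k ih =>
    intro t s hs
    rw [runK]
    have : ((k+1 : ℕ) : ENNReal) * (4 * δ) = 4 * δ + k * (4 * δ) := by push_cast; ring
    rw [this]
    refine boundK _ _ _ _ _ _ (stepaccK pm S Gam Q δ hG0 hGm hSQ hδ (n t) (U t) (n (t+1)) (U (t+1))
      (hU t) K E (hUK _) hE0 hE1 s hs) fun s' hs' => ?_
    simp only [Set.mem_ofPred_eq, not_not] at hs'
    rw [PMF.toOuterMeasure_map_apply]
    refine le_trans ((runK pm _ S n k (t+1) s').toOuterMeasure.mono ?_) (ih (t+1) s' hs'.1)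
    intro l hl
    simp only [Set.mem_preimage, Set.mem_ofPred_eq] at hl ⊢
    intro h
    apply hl
    intro i hi
    cases i with
    | zero => simpa using hs'.2
    | succ i =>
      have := h i (by omega)
      simpa [add_assoc, add_comm, add_left_comm] using this

def extK {d T : ℕ} (x : Fin T → CardOp d) : ℕ → CardOp d :=
  fun n => if h : n < T then x ⟨n, h⟩ else ((true, ∅) : CardOp d)

theorem extK_lt {d T : ℕ} (x : Fin T → CardOp d) (t : ℕ) (h : t < T) : extK x t = x ⟨t, h⟩ := dif_pos h

theorem extK_ge {d T : ℕ} (x : Fin T → CardOp d) (t : ℕ) (h : ¬ t < T) :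
    extK x t = ((true, ∅) : CardOp d) := dif_neg h

def cntK {d T : ℕ} (x : Fin T → CardOp d) (t : ℕ) : ℕ := (DcardN (extK x) t).card

def updK {d T : ℕ} (x : Fin T → CardOp d) (t : ℕ) : ℕ := ∑ i ∈ Finset.range t, (extK x i).2.card

theorem applyK {d : ℕ} (D : Finset (Fin d)) (op : CardOp d) :
    |((CardOp.apply D op).card : ℝ) - D.card| ≤ op.2.card := by
  have h1 : (CardOp.apply D op).card ≤ D.card + op.2.card := by
    unfold CardOp.apply
    split_ifs
    · exact Finset.card_union_le _ _
    · exact (Finset.card_le_card Finset.sdiff_subset).trans (by omega)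
  have h2 : D.card ≤ (CardOp.apply D op).card + op.2.card := by
    unfold CardOp.apply
    split_ifs
    · exact (Finset.card_le_card (Finset.subset_union_left (s₂ := op.2))).trans (Nat.le_add_right _ _)
    · have := Finset.le_card_sdiff op.2 D
      omega
  have h1' : ((CardOp.apply D op).card : ℝ) ≤ D.card + op.2.card := by exact_mod_cast h1
  have h2' : (D.card : ℝ) ≤ (CardOp.apply D op).card + op.2.card := by exact_mod_cast h2
  rw [abs_le]; constructor <;> linarith

theorem cnt_updK {d T : ℕ} (x : Fin T → CardOp d) (t : ℕ) :
    |(cntK x (t+1) : ℝ) - cntK x t| ≤ updK x (t+1) - updK x t := by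
  have : (updK x (t+1) : ℝ) - updK x t = (extK x t).2.card := by
    rw [updK, Finset.sum_range_succ, ← updK]; push_cast; ring
  rw [this]
  exact applyK _ _

theorem upd_leK {d T : ℕ} (x : Fin T → CardOp d) (t : ℕ) : updK x t ≤ updateCount x := by
  have h : updateCount x = updK x T := by
    rw [updateCount, updK, Finset.sum_range]
    apply Finset.sum_congr rfl
    intro i _
    simp [extK]
  rw [h]
  have h2 : ∀ i, T ≤ i → (extK x i).2.card = 0 := by
    intro i hi; simp [extK, not_lt.2 hi]
  rcases le_total t T with ht | ht
  · exact Finset.sum_le_sum_of_subset (by simpa using ht)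
  · unfold updK
    rw [← Finset.sum_subset (s₁ := Finset.range T) (by simpa using ht)]
    intro i _ hi
    exact h2 i (by simpa using hi)

theorem neighK {d T : ℕ} (x y : Fin T → CardOp d) (h : UserNeighboring x y) (t : ℕ) :
    cntK x t = cntK y t ∨ cntK x t = cntK y t + 1 ∨ cntK y t = cntK x t + 1 := by
  obtain ⟨i, hi⟩ := h
  have key : (DcardN (extK x) t).erase i = (DcardN (extK y) t).erase i := by
    induction t with
    | zero => rfl
    | succ t ih =>
      have he : (extK x t).1 = (extK y t).1 ∧ (extK x t).2.erase i = (extK y t).2.erase i := by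
        by_cases ht : t < T
        · have := hi ⟨t, ht⟩
          rw [extK_lt x t ht, extK_lt y t ht]; exact this
        · rw [extK_ge x t ht, extK_ge y t ht]; exact ⟨rfl, rfl⟩
      obtain ⟨h1, h2⟩ := he
      simp only [DcardN, CardOp.apply, h1]
      rw [Finset.ext_iff] at ih h2 ⊢
      intro z
      have a1 := ih z
      have a2 := h2 z
      split_ifs <;> simp at a1 a2 ⊢ <;> tauto
  have c := congrArg Finset.card key
  rw [Finset.card_erase_eq_ite, Finset.card_erase_eq_ite] at c
  unfold cntK
  split_ifs at c with h1 h2 h2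
  · have := Finset.card_pos.2 ⟨_, h1⟩
    have := Finset.card_pos.2 ⟨_, h2⟩
    omega
  · have := Finset.card_pos.2 ⟨_, h1⟩
    omega
  · have := Finset.card_pos.2 ⟨_, h2⟩
    omega
  · omega

theorem cnt_congrK {d T : ℕ} (x y : Fin T → CardOp d) (t : Fin T) (h : ∀ s, s ≤ t → x s = y s)
    (i : ℕ) (hi : i ≤ t.1 + 1) : cntK x i = cntK y i := by
  have : DcardN (extK x) i = DcardN (extK y) i := by
    induction i with
    | zero => rfl
    | succ i ih =>
      have hi' : i < T := by omega
      simp only [DcardN]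
      rw [ih (by omega)]
      congr 1
      have hh := h ⟨i, hi'⟩ (by rw [Fin.le_def]; simp only; omega)
      rw [extK_lt x i hi', extK_lt y i hi']; exact hh
  rw [cntK, this, cntK]

theorem cnt_leK {d T : ℕ} (x : Fin T → CardOp d) (t : ℕ) : cntK x t ≤ d := by
  have := Finset.card_le_univ (DcardN (extK x) t)
  rw [Fintype.card_fin] at this
  exact this

theorem numK (A : ℝ) : ∃ j : ℕ, A * ((j+2) * (j+3)) ≤ 2^j := by
  have h1 : Filter.Tendsto (fun n : ℕ => (n:ℝ)^2 * (1/2)^n) Filter.atTop (nhds 0) :=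
    tendsto_pow_const_mul_const_pow_of_abs_lt_one 2 (by norm_num [abs_of_pos])
  obtain ⟨N, hN⟩ := Filter.eventually_atTop.1 (h1.eventually_lt_const (show (0:ℝ) < 1 / (12 * (|A| + 1)) by positivity))
  have h := hN (N+1) (by omega)
  refine ⟨N+1, ?_⟩
  set n : ℝ := ((N+1 : ℕ) : ℝ) with hn
  have hn1 : 1 ≤ n := by rw [hn]; push_cast; linarith [Nat.cast_nonneg (α := ℝ) N]
  have hp : (0:ℝ) < 2^(N+1) := by positivity
  rw [one_div, inv_pow, ← div_eq_mul_inv, div_lt_div_iff₀ hp (by positivity)] at h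
  have hA : A ≤ |A| + 1 := by linarith [le_abs_self A]
  have hq : (n+2)*(n+3) ≤ 12 * n^2 := by nlinarith
  calc A * ((n+2)*(n+3)) ≤ (|A|+1) * ((n+2)*(n+3)) := by gcongr
    _ ≤ (|A|+1) * (12 * n^2) := by gcongr
    _ ≤ _ := by linarith

theorem mainK : 
    ∀ (ε β : ℝ) (d T : ℕ),
        0 < ε → β ∈ Set.Ioo (0 : ℝ) 1 → 1 ≤ d → 1 ≤ T →
        ∃ (pm : ℕ → PMF ℕ) (S : ℕ → ℕ) (η Gam Q : ℕ → ℝ) (δ : ENNReal) (B : ℕ × ℕ → ℝ),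
        (∀ j k, pm j k ≤ ENNReal.ofReal (Real.exp (η j)) * pm j (k+1)) ∧
        (∀ j, 0 ≤ η j) ∧ (∀ i, 0 ≤ B i) ∧ (∀ i, 4 * η i.1 + B (nxtK S i) ≤ B i) ∧
        η 0 + B (0,0) ≤ ε ∧
        (∀ j, 0 ≤ Gam j) ∧ Monotone Gam ∧ (∀ j, Q j ≤ S j * Gam j) ∧
        (∀ j, (pm j).toOuterMeasure {g | Gam j < (g:ℝ)} ≤ δ) ∧
        δ + T * (4 * δ) ≤ ENNReal.ofReal β ∧
        ∀ K : ℕ, 1 ≤ K → 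
          min (K:ℝ) (4 * Gam 0) ≤ 144 * min (K:ℝ) (log2c K * Real.sqrt (ε⁻¹ * K * log2c ((T:ℝ)/β))) ∧
          ∀ j, PK Gam Q j K → 4 * Gam j ≤ 144 * min (K:ℝ) (log2c K * Real.sqrt (ε⁻¹ * K * log2c ((T:ℝ)/β))) := by
  intro ε β d T hε hβ hd hT
  have hT' : (1:ℝ) ≤ T := by exact_mod_cast hT
  have hlog1 : ∀ z : ℝ, 1 ≤ log2c z := by
    intro z
    rw [log2c, Real.le_logb_iff_rpow_le (by norm_num) (by positivity)]
    simp
  set L := log2c ((T:ℝ)/β) with hL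
  have hL1 : 1 ≤ L := hlog1 _
  set A := 32 * L / ε with hA
  have hA0 : 0 < A := by positivity
  set J := Nat.find (numK A) with hJ
  set R : ℕ → ℝ := fun j => Real.sqrt (A * 2^j * ((j+2)*(j+3))) with hR
  have hRpos : ∀ j, 0 < R j := fun j => by simp only [hR]; positivity
  have hRsq : ∀ j, R j ^ 2 = A * 2^j * ((j+2)*(j+3)) := fun j => Real.sq_sqrt (by positivity)
  have hRm : Monotone R := by
    intro a b hab
    apply Real.sqrt_le_sqrt
    have : (a:ℝ) ≤ b := by exact_mod_cast hab
    have h2 : (2:ℝ)^a ≤ 2^b := pow_le_pow_right₀ (by norm_num) hab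
    gcongr
  have hJle : ∀ j, A * (((J + j : ℕ):ℝ)+2) * (((J+j : ℕ):ℝ)+3) ≤ 2^(J+j) := by
    intro j
    induction j with
    | zero => have := Nat.find_spec (numK A); rw [← hJ] at this; simpa [mul_assoc] using this
    | succ j ih =>
      rw [← add_assoc, pow_succ]
      push_cast at ih ⊢
      have hj : (0:ℝ) ≤ (J:ℝ) + j := by positivity
      have hwd : (J:ℝ) + (j+1) = (J:ℝ) + j + 1 := by ring
      generalize (J:ℝ) + j = w at *
      have : w + 1 + 3 ≤ 2 * (w + 2) := by linarith
      calc A * (w + 1 + 2) * (w + 1 + 3) = A * (w + 3) * (w + 1 + 3) := by ring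
        _ ≤ A * (w+3) * (2 * (w+2)) := by gcongr
        _ ≤ _ := by nlinarith
  have hRle : ∀ j, R (J+j) ≤ 2^(J+j) := by
    intro j
    apply Real.sqrt_le_iff.2 ⟨by positivity, ?_⟩
    have := hJle j
    have h2 : (0:ℝ) < 2^(J+j) := by positivity
    nlinarith
  have hex := fun j => exists_geom (4 * L / R (J+j)) (by have := hRpos (J+j); positivity)
  choose pm hpm1 hpm2 using hex
  set Sf : ℕ → ℕ := fun j => ⌈(2:ℝ)^(J+j) / R (J+j)⌉₊ with hSf
  set η : ℕ → ℝ := fun j => 4 * L / R (J+j) with hη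
  have hη0 : ∀ j, 0 < η j := fun j => by have := hRpos (J+j); simp only [hη]; positivity
  have hSpos : ∀ j, 1 ≤ Sf j := by
    intro j
    apply Nat.ceil_pos.2
    have := hRpos (J+j); positivity
  have hSle : ∀ j, 4 * η j * Sf j ≤ ε / (((J+j : ℕ):ℝ)+2) - ε / (((J+j : ℕ):ℝ)+3) := by
    intro j
    have hr := hRpos (J+j)
    have h1 : (Sf j : ℝ) ≤ 2 * (2^(J+j) / R (J+j)) := by
      have h2 := (Nat.ceil_lt_add_one (a := (2:ℝ)^(J+j) / R (J+j)) (by positivity)).le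
      have h3 : 1 ≤ (2:ℝ)^(J+j) / R (J+j) := by rw [le_div_iff₀ hr]; simpa using hRle j
      simp only [hSf]; linarith
    calc 4 * η j * Sf j ≤ 4 * η j * (2 * (2^(J+j) / R (J+j))) := by have := hη0 j; gcongr
      _ = 32 * L * 2^(J+j) / (R (J+j))^2 := by simp only [hη]; field_simp; ring
      _ = _ := by
        rw [hRsq, hA]
        field_simp
        ring
  refine ⟨pm, Sf, η, fun j => R (J+j), fun j => 2^(J+j), ENNReal.ofReal (Real.exp (-(4*L))),
    fun i => 4 * η i.1 * (max ((Sf i.1:ℝ) - i.2) 1) + ε / (((J+i.1 : ℕ):ℝ)+3), hpm1, fun j => (hη0 j).le, ?_, ?_, ?_,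
    fun j => (hRpos _).le, ?_, ?_, ?_, ?_, ?_⟩
  · intro i
    have := hη0 i.1
    have : 0 ≤ max ((Sf i.1:ℝ) - i.2) 1 := le_max_of_le_right (by norm_num)
    positivity
  · intro i
    have h0 := hη0 i.1
    unfold nxtK
    split_ifs with h
    · simp only
      have h1 := hSle (i.1+1)
      have h2 : max ((Sf (i.1+1):ℝ) - (0:ℕ)) 1 = Sf (i.1+1) := by
        simp; exact hSpos _
      rw [h2]
      have h3 : 4 * η i.1 * 1 ≤ 4 * η i.1 * max ((Sf i.1:ℝ) - i.2) 1 := by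
        gcongr; exact le_max_right _ _
      have h4 : ε / (((J + (i.1 + 1) : ℕ):ℝ) + 2) = ε / (((J+i.1 : ℕ):ℝ)+3) := by
        push_cast; congr 1; ring
      rw [h4] at h1
      linarith
    · simp only
      have h' : (i.2:ℝ) + 2 ≤ Sf i.1 := by
        have : i.2 + 2 ≤ Sf i.1 := by omega
        exact_mod_cast this
      rw [max_eq_left (by push_cast; linarith), max_eq_left (by linarith)]
      push_cast
      linarith
  · simp only
    have h1 := hSle 0
    have h2 : max ((Sf 0:ℝ) - (0:ℕ)) 1 = Sf 0 := by
        simp; exact hSpos _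
    rw [h2]
    have h3 : ε / (((J + 0 : ℕ):ℝ) + 2) ≤ ε / 2 := by
      apply div_le_div_of_nonneg_left hε.le (by norm_num)
      linarith [Nat.cast_nonneg (α := ℝ) (J+0)]
    have h4 : 0 ≤ ε / (((J+0 : ℕ):ℝ)+3) := by positivity
    have h5 : 4 * η 0 * 1 ≤ 4 * η 0 * Sf 0 := by
      have := hη0 0
      gcongr
      exact_mod_cast hSpos 0
    linarith
  · intro a b hab
    exact hRm (by omega)
  · intro j
    have := Nat.le_ceil ((2:ℝ)^(J+j) / R (J+j))
    rwa [div_le_iff₀ (hRpos _)] at this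
  · intro j
    refine (hpm2 j _).trans (le_of_eq ?_)
    have := hRpos (J+j)
    congr 3
    field_simp
  · have hz : (T:ℝ)/β ≤ max ((T:ℝ)/β) 2 := le_max_left _ _
    set z := max ((T:ℝ)/β) 2 with hzdef
    have hz2 : 2 ≤ z := le_max_right _ _
    have h2L : (2:ℝ)^L = z := by
      rw [hL, log2c]; exact Real.rpow_logb (by norm_num) (by norm_num) (by positivity)
    have hexp : z ^ 4 ≤ Real.exp (4 * L) := by
      rw [← h2L, ← Real.rpow_natCast, ← Real.rpow_mul (by norm_num), Real.rpow_def_of_pos (by norm_num)]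
      apply Real.exp_le_exp.2
      have := Real.log_two_lt_d9
      push_cast
      nlinarith
    have h8 : 8 * z ≤ z^4 := by
      have : 8 ≤ z^3 := by
        calc (8:ℝ) = 2^3 := by norm_num
          _ ≤ z^3 := by gcongr
      nlinarith
    have hb : 5 * T * Real.exp (-(4*L)) ≤ β := by
      rw [Real.exp_neg, ← div_eq_mul_inv, div_le_iff₀ (Real.exp_pos _)]
      rw [div_le_iff₀ hβ.1] at hz
      have := hβ.1
      nlinarith
    have e1 : ENNReal.ofReal (Real.exp (-(4*L))) + T * (4 * ENNReal.ofReal (Real.exp (-(4*L)))) =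
        ENNReal.ofReal ((1 + T * 4) * Real.exp (-(4*L))) := by
      rw [ENNReal.ofReal_mul (by positivity), ENNReal.ofReal_add (by norm_num) (by positivity),
        ENNReal.ofReal_mul (by positivity)]
      simp
      ring
    rw [e1]
    apply ENNReal.ofReal_le_ofReal
    have := Real.exp_pos (-(4*L))
    nlinarith
  · intro K hK
    have hK1 : (1:ℝ) ≤ K := by exact_mod_cast hK
    set lk := log2c (K:ℝ) with hlk
    have hlk1 : 1 ≤ lk := hlog1 _
    have hlkK : (K:ℝ) ≤ 2 ^ lk := by
      rw [hlk, log2c, Real.rpow_logb (by norm_num) (by norm_num) (by positivity)]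
      exact le_max_left _ _
    set W := lk * Real.sqrt (ε⁻¹ * K * L) with hW
    have hW0 : 0 ≤ W := by positivity
    have hWsq : W^2 = lk^2 * (ε⁻¹ * K * L) := by
      rw [hW, mul_pow, Real.sq_sqrt (by positivity)]
    have hjl : ∀ j : ℕ, (2:ℝ)^j ≤ 2 * K → (j:ℝ) ≤ lk + 1 := by
      intro j hj
      have : (2:ℝ)^(j:ℝ) ≤ 2^(lk + 1) := by
        rw [Real.rpow_natCast, Real.rpow_add (by norm_num), Real.rpow_one]
        linarith
      exact (Real.rpow_le_rpow_left_iff (by norm_num)).1 this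
    have big : ∀ j : ℕ, (2:ℝ)^(J+j) ≤ 2 * K → 4 * R (J+j) ≤ 144 * min (K:ℝ) W := by
      intro j hj
      have h1 := hjl _ hj
      have h2 := hRle j
      rw [mul_min_of_nonneg _ _ (by norm_num)]
      apply le_min
      · linarith
      · have h3 : R (J+j) ^ 2 ≤ (36 * W)^2 := by
          rw [hRsq, mul_pow, hWsq]
          have h4 : (((J+j : ℕ):ℝ)+2) * (((J+j : ℕ):ℝ)+3) ≤ 20 * lk^2 := by
            have : (0:ℝ) ≤ ((J+j : ℕ):ℝ) := Nat.cast_nonneg _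
            nlinarith
          calc A * 2^(J+j) * ((((J+j : ℕ):ℝ)+2) * (((J+j : ℕ):ℝ)+3)) ≤ A * (2 * K) * (20 * lk^2) := by gcongr
            _ = 1280 * (lk^2 * (ε⁻¹ * K * L)) := by rw [hA]; field_simp; ring
            _ ≤ _ := by
              have : 0 ≤ lk^2 * (ε⁻¹ * K * L) := by positivity
              nlinarith
        have := abs_le_of_sq_le_sq h3 (by positivity)
        linarith [le_abs_self (R (J+j))]
    have small : (K:ℝ) < 2^J → 4 * (K:ℝ) ≤ 144 * min (K:ℝ) W := by
      intro hKJ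
      have hKJ' : K < 2^J := by exact_mod_cast hKJ
      set k := Nat.log 2 K with hk
      have hkJ : k < J := Nat.log_lt_of_lt_pow (by omega) hKJ'
      have h1 := Nat.find_min (numK A) hkJ
      push Not at h1
      have h2 : K < 2^(k+1) := Nat.lt_pow_succ_log_self (by norm_num) K
      have h2' : (K:ℝ) < 2 * 2^k := by
        have : (K:ℝ) < 2^(k+1) := by exact_mod_cast h2
        rw [pow_succ] at this; linarith
      have h3 : 2^k ≤ K := Nat.pow_log_le_self 2 (by omega)
      have h3' : (2:ℝ)^k ≤ K := by exact_mod_cast h3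
      have h4 : (k:ℝ) ≤ lk + 1 := hjl k (by linarith)
      have h5 : ((k:ℝ)+2) * ((k:ℝ)+3) ≤ 20 * lk^2 := by
        have : (0:ℝ) ≤ (k:ℝ) := Nat.cast_nonneg _
        nlinarith
      have h6 : (K:ℝ) ≤ 40 * A * lk^2 := by
        have : A * (((k:ℝ)+2) * ((k:ℝ)+3)) ≤ A * (20 * lk^2) := by gcongr
        linarith
      rw [mul_min_of_nonneg _ _ (by norm_num)]
      apply le_min
      · linarith
      · have h7 : (K:ℝ) ^ 2 ≤ (36 * W)^2 := by
          rw [mul_pow, hWsq]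
          calc (K:ℝ)^2 = K * K := by ring
            _ ≤ (40 * A * lk^2) * K := by gcongr
            _ = 1280 * (lk^2 * (ε⁻¹ * K * L)) := by rw [hA]; field_simp; ring
            _ ≤ _ := by
              have : 0 ≤ lk^2 * (ε⁻¹ * K * L) := by positivity
              nlinarith
        have := abs_le_of_sq_le_sq h7 (by positivity)
        linarith [le_abs_self (K:ℝ)]
    refine ⟨?_, ?_⟩
    · rcases lt_or_ge (K:ℝ) (2^J) with h | h
      · exact (min_le_left _ _).trans (le_trans (by linarith) (small h))
      · exact (min_le_right _ _).trans (big 0 (by simp; linarith))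
    · rintro j (⟨rfl, h⟩ | ⟨k, rfl, h⟩)
      · rcases lt_or_ge (K:ℝ) (2^J) with h' | h'
        · exact le_trans (by linarith) (small h')
        · exact big 0 (by simp; linarith)
      · exact big (k+1) (by rw [← add_assoc, pow_succ]; linarith)

end

theorem set_cardinality_upper_bound_unknown_K :
    ∃ C : ℝ, 0 < C ∧
      ∀ (ε β : ℝ) (d T : ℕ),
        0 < ε → β ∈ Set.Ioo (0 : ℝ) 1 → 1 ≤ d → 1 ≤ T →
        ∃ M : (Fin T → CardOp d) → Measure (Fin T → ℝ),
          IsCOMech M ∧ IsUserDP ε M ∧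
          ∀ x : Fin T → CardOp d, 1 ≤ updateCount x →
            ENNReal.ofReal (1 - β) ≤
              M x {a | ∀ t : Fin T, |a t - ((Dcard x t).card : ℝ)| ≤
                C * min (d : ℝ) (min ((updateCount x : ℕ) : ℝ)
                  (log2c ((updateCount x : ℕ) : ℝ) *
                    Real.sqrt (ε⁻¹ * ((updateCount x : ℕ) : ℝ) *
                      log2c ((T : ℝ) / β))))} := by
  refine ⟨144, by norm_num, ?_⟩
  intro ε β d T hε hβ hd hT
  obtain ⟨pm, S, η, Gam, Q, δ, B, hpm, hη, hB0, hB, hBε, hG0, hGm, hSQ, hδ, hδβ, hK⟩ :=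
    mainK ε β d T hε hβ hd hT
  set a : ℕ → ℝ := fun j => 3 * Gam j with ha
  set f : List ℤ → Fin T → ℝ := fun l t => max 0 (min (d:ℝ) ((l.getD t.1 0 : ℤ) : ℝ)) with hf
  set P : (Fin T → CardOp d) → ℕ → PMF (List ℤ) := fun x k =>
    (pm 0).bind fun r => runK pm a S (cntK x) k 0 ⟨(0,0), 0, r⟩ with hP
  refine ⟨fun x => ((P x T).map f).toMeasure, ⟨?_, ?_, ?_⟩, ?_, ?_⟩
  · have : Finite (CardOp d) := inferInstanceAs (Finite (Bool × Finset (Fin d)))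
    have : DiscreteMeasurableSpace (CardOp d) := ⟨fun _ => trivial⟩
    exact Measurable.of_discrete
  · intro x
    exact PMF.toMeasure.isProbabilityMeasure _
  · intro t x y hxy
    have hPk : ∀ z : Fin T → CardOp d, (P z T).map (List.take (t.1+1)) = P z (t.1+1) := by
      intro z
      simp only [hP, PMF.map_bind]
      congr 1; ext1 r
      exact causK1 pm a S (cntK z) (t.1+1) T 0 _ (by omega)
    have hPxy : P x (t.1+1) = P y (t.1+1) := by
      simp only [hP]
      congr 1; ext1 r
      exact causK2 pm a S _ _ (t.1+1) 0 _ fun i hi => cnt_congrK x y t hxy i (by omega)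
    have hmeas : Measurable (fun (a : Fin T → ℝ) (s : {s : Fin T // s ≤ t}) => a s.1) :=
      measurable_pi_lambda _ fun s => measurable_pi_apply _
    have hfac : ((fun (a : Fin T → ℝ) (s : {s : Fin T // s ≤ t}) => a s.1) ∘ f) =
      ((fun (a : Fin T → ℝ) (s : {s : Fin T // s ≤ t}) => a s.1) ∘ f) ∘ List.take (t.1+1) := by
      funext l s
      have hs : s.1.1 < t.1 + 1 := by have := s.2; simp only [Fin.le_def] at this; omega
      simp [hf, hs]
    have hall : ∀ z : Fin T → CardOp d, (((P z T).map f).toMeasure).map (fun (a : Fin T → ℝ) (s : {s : Fin T // s ≤ t}) => a s.1) =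
        ((P z (t.1+1)).map ((fun (a : Fin T → ℝ) (s : {s : Fin T // s ≤ t}) => a s.1) ∘ f)).toMeasure := by
      intro z
      rw [PMF.toMeasure_map _ _ hmeas, PMF.map_comp, hfac, ← PMF.map_comp, hPk, ← hfac]
    rw [hall, hall, hPxy]
  · intro x y hxy A hA
    rw [PMF.toMeasure_apply_eq_toOuterMeasure_apply _ hA, PMF.toMeasure_apply_eq_toOuterMeasure_apply _ hA,
      PMF.toOuterMeasure_map_apply, PMF.toOuterMeasure_map_apply]
    simp only [hP, PMF.toOuterMeasure_bind_apply]
    have h1 := shiftK (pm 0) _ 1 (hpm 0)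
      (fun r => (runK pm a S (cntK x) T 0 ⟨(0,0), 0, r⟩).toOuterMeasure (f ⁻¹' A))
      (fun r => (runK pm a S (cntK y) T 0 ⟨(0,0), 0, r⟩).toOuterMeasure (f ⁻¹' A))
      (ENNReal.ofReal (Real.exp (B (0,0))))
      (fun r => privK pm a S η B hpm hη hB0 hB (cntK x) (cntK y) (neighK x y hxy) T 0
        ⟨(0,0), 0, r⟩ (f ⁻¹' A))
    refine h1.trans (mul_le_mul_left ?_ _)
    rw [pow_one, ← ENNReal.ofReal_mul (Real.exp_pos _).le, ← Real.exp_add]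
    exact ENNReal.ofReal_le_ofReal (Real.exp_le_exp.2 hBε)
  · intro x hx
    obtain ⟨hE0, hE1⟩ := hK (updateCount x) hx
    set W := log2c ((updateCount x : ℕ) : ℝ) * Real.sqrt (ε⁻¹ * ((updateCount x : ℕ) : ℝ) *
                      log2c ((T : ℝ) / β)) with hW
    set E := 144 * min ((updateCount x : ℕ) : ℝ) W with hE
    set bad : Set (List ℤ) := {l | ¬ ∀ i < T, |((l.getD i 0 : ℤ):ℝ) - cntK x (0+1+i)| ≤ E} with hbad
    have hb : (P x T).toOuterMeasure bad ≤ ENNReal.ofReal β := by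
      refine le_trans ?_ hδβ
      refine boundK _ _ _ _ _ _ (hδ 0) fun r hr => ?_
      refine accK pm S Gam Q δ hG0 hGm hSQ hδ (cntK x) (updK x) (cnt_updK x) (updateCount x : ℕ) E
        (fun t => by exact_mod_cast upd_leK x t) hE0 hE1 T 0 _ ?_
      refine ⟨0, 0, ?_, ?_, ?_, ?_, Or.inl ⟨rfl, rfl, rfl, rfl⟩⟩
      · simpa using hG0 0
      · simp [cntK, DcardN]
      · simp
      · simpa using hr
    refine le_trans ?_ (PMF.toOuterMeasure_apply_le_toMeasure_apply _ _)
    rw [PMF.toOuterMeasure_map_apply]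
    have hone : (1 : ENNReal) ≤ (P x T).toOuterMeasure badᶜ + (P x T).toOuterMeasure bad := by
      calc (1 : ENNReal) = (P x T).toOuterMeasure Set.univ := by
            rw [((P x T).toOuterMeasure_apply_eq_one_iff _).2 (Set.subset_univ _)]
        _ = (P x T).toOuterMeasure (badᶜ ∪ bad) := by rw [Set.compl_union_self]
        _ ≤ _ := measure_union_le _ _
    have h2 : ENNReal.ofReal (1 - β) ≤ (P x T).toOuterMeasure badᶜ := by
      rw [ENNReal.ofReal_sub _ hβ.1.le, ENNReal.ofReal_one, tsub_le_iff_right]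
      exact hone.trans (by gcongr)
    refine h2.trans ((P x T).toOuterMeasure.mono ?_)
    intro l hl
    simp only [hbad, Set.mem_compl_iff, Set.mem_ofPred_eq, not_not] at hl
    simp only [Set.mem_preimage, Set.mem_ofPred_eq]
    intro t
    have h3 := hl t.1 t.2
    have h4 : Dcard x t = DcardN (extK x) (t.1+1) := rfl
    have h5 : ((Dcard x t).card : ℝ) = cntK x (0+1+t.1) := by
      rw [h4, cntK]; congr 3; omega
    have h6 : (cntK x (0+1+t.1) : ℝ) ≤ d := by exact_mod_cast cnt_leK x _
    have h7 : (0:ℝ) ≤ cntK x (0+1+t.1) := Nat.cast_nonneg _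
    rw [h5]
    set v := (cntK x (0+1+t.1) : ℝ)
    set u := ((l.getD t.1 0 : ℤ) : ℝ) with hu
    have hfl : f l t = max 0 (min (d:ℝ) u) := rfl
    rw [hfl]
    have hmin : 144 * min (d:ℝ) (min ((updateCount x : ℕ) : ℝ) W) = min (144 * (d:ℝ)) E := by
      rw [mul_min_of_nonneg _ _ (by norm_num)]
    rw [hmin]
    rw [abs_le] at h3
    have hd0 : (0:ℝ) ≤ d := Nat.cast_nonneg _
    apply le_min
    · have : max 0 (min (d:ℝ) u) ≤ d := max_le hd0 (min_le_left _ _)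
      have : 0 ≤ max 0 (min (d:ℝ) u) := le_max_left _ _
      rw [abs_le]; constructor <;> linarith
    · rw [abs_le]
      rcases max_cases 0 (min (d:ℝ) u) with h | h <;> rcases min_cases (d:ℝ) u with h' | h' <;>
        constructor <;> linarith
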